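/- arXiv:1608.00664 — 5 statements merged into one kernel-verified Lean document; each statement's English description precedes it below -/
import Mathlib

section
/- Associativity of the transformation groupoid multiplication: given a 2-term representation up to homotopy (Δ^C, Δ^E, Ω) of a groupoid 𝒢 on (∂ : C → E), and elements (c₁, g₁, e₁), (c₂, g₂, e₂), (c₃, g₃, e₃) of the transformation groupoid with g₃ : w → x, g₂ : x → y, g₁ : y → z, e₂ = ∂_w(c₃) + Δ^E_{g₃}(e₃) and e₁ = ∂_x(c₂) + Δ^E_{g₂}(e₂), the multiplication is associative: ((c₁,g₁,e₁)·(c₂,g₂,e₂))·(c₃,g₃,e₃) = (c₁,g₁,e₁)·((c₂,g₂,e₂)·(c₃,g₃,e₃)); explicitly, c₁ + Δ^C_{g₁}(c₂) − Ω_{g₁,g₂}(e₂) + Δ^C_{g₁g₂}(c₃) − Ω_{g₁g₂,g₃}(e₃) = c₁ + Δ^C_{g₁}(c₂ + Δ^C_{g₂}(c₃) − Ω_{g₂,g₃}(e₃)) − Ω_{g₁,g₂g₃}(e₃). -/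
open CategoryTheory

/-- Associativity of the multiplication in the transformation groupoid of a
2-term representation up to homotopy `(Δ^C, Δ^E, Ω)` of a groupoid `𝒢` on `(∂ : C → E)`.
Composition is written with `g₁g₂ = g₂ ≫ g₁` for `g₂ : x ⟶ y`, `g₁ : y ⟶ z`. -/
theorem transformation_groupoid_mul_assoc
    {G : Type*} [Groupoid G] {R : Type*} [CommRing R]
    (C E : G → Type*)
    [∀ x, AddCommGroup (C x)] [∀ x, Module R (C x)]
    [∀ x, AddCommGroup (E x)] [∀ x, Module R (E x)]
    (d : ∀ x, C x →ₗ[R] E x)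
    (ΔC : ∀ {x y : G}, (x ⟶ y) → (C x →ₗ[R] C y))
    (ΔE : ∀ {x y : G}, (x ⟶ y) → (E x →ₗ[R] E y))
    (Ω : ∀ {x y z : G}, (y ⟶ z) → (x ⟶ y) → (E x →ₗ[R] C z))
    -- (i) ∂ ∘ Δ^C_g = Δ^E_g ∘ ∂
    (h1 : ∀ {x y : G} (g : x ⟶ y), d y ∘ₗ ΔC g = ΔE g ∘ₗ d x)
    -- (ii) Δ^C_{g₁g₂} − Δ^C_{g₁} ∘ Δ^C_{g₂} = Ω_{g₁,g₂} ∘ ∂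
    (h2 : ∀ {x y z : G} (g₁ : y ⟶ z) (g₂ : x ⟶ y),
      ΔC (g₂ ≫ g₁) - ΔC g₁ ∘ₗ ΔC g₂ = Ω g₁ g₂ ∘ₗ d x)
    -- (iii) ∂ ∘ Ω_{g₁,g₂} = Δ^E_{g₁g₂} − Δ^E_{g₁} ∘ Δ^E_{g₂}
    (h3 : ∀ {x y z : G} (g₁ : y ⟶ z) (g₂ : x ⟶ y),
      d z ∘ₗ Ω g₁ g₂ = ΔE (g₂ ≫ g₁) - ΔE g₁ ∘ₗ ΔE g₂)
    -- (iv) cocycle condition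
    (h4 : ∀ {w x y z : G} (g₁ : y ⟶ z) (g₂ : x ⟶ y) (g₃ : w ⟶ x),
      Ω (g₂ ≫ g₁) g₃ - Ω g₁ (g₃ ≫ g₂) = ΔC g₁ ∘ₗ Ω g₂ g₃ - Ω g₁ g₂ ∘ₗ ΔE g₃)
    {w x y z : G} (g₁ : y ⟶ z) (g₂ : x ⟶ y) (g₃ : w ⟶ x)
    (c₁ : C z) (c₂ : C y) (c₃ : C x)
    (e₁ : E y) (e₂ : E x) (e₃ : E w)
    (he₂ : e₂ = d x c₃ + ΔE g₃ e₃)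
    (he₁ : e₁ = d y c₂ + ΔE g₂ e₂) :
    c₁ + ΔC g₁ c₂ - Ω g₁ g₂ e₂ + ΔC (g₂ ≫ g₁) c₃ - Ω (g₂ ≫ g₁) g₃ e₃ =
      c₁ + ΔC g₁ (c₂ + ΔC g₂ c₃ - Ω g₂ g₃ e₃) - Ω g₁ (g₃ ≫ g₂) e₃ := by
  have hC := LinearMap.congr_fun (h2 g₁ g₂) c₃
  have hΩ := LinearMap.congr_fun (h4 g₁ g₂ g₃) e₃
  simp only [LinearMap.sub_apply, LinearMap.comp_apply] at hC hΩ
  simp only [he₂, map_add, map_sub]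
  linear_combination (norm := module) hC - hΩ
end

section
/- Existence of two-sided inverses in the transformation groupoid: given a 2-term representation up to homotopy (Δ^C, Δ^E, Ω) of a groupoid 𝒢 on (∂ : C → E) which is moreover unital and normalized, and an element (c, g, e) with g : x → y, c ∈ C_y, e ∈ E_x, set ι(c,g,e) := (Ω_{g⁻¹,g}(e) − Δ^C_{g⁻¹}(c), g⁻¹, ∂_y(c) + Δ^E_g(e)). Then ι(c,g,e) is composable with (c,g,e) on either side and ι(c,g,e)·(c,g,e) = (0, 1_x, e) and (c,g,e)·ι(c,g,e) = (0, 1_y, ∂_y(c) + Δ^E_g(e)), i.e. both products are units of the transformation groupoid. -/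
open CategoryTheory

/-- Existence of two-sided inverses in the transformation groupoid of a
unital, normalized 2-term representation up to homotopy `(Δ^C, Δ^E, Ω)` of `𝒢` on
`(∂ : C → E)`.  For `(c, g, e)` with `g : x ⟶ y`, set
`ι(c,g,e) := (Ω_{g⁻¹,g}(e) − Δ^C_{g⁻¹}(c), g⁻¹, ∂ c + Δ^E_g e)`.  Then `ι(c,g,e)` is
composable with `(c,g,e)` on either side and both products are units:
`ι(c,g,e)·(c,g,e) = (0, 𝟙ₓ, e)` and `(c,g,e)·ι(c,g,e) = (0, 𝟙_y, ∂ c + Δ^E_g e)`.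
Composition is written with `g₁g₂ = g₂ ≫ g₁` for `g₂ : x ⟶ y`, `g₁ : y ⟶ z`. -/
theorem transformation_groupoid_inverses
    {G : Type*} [Groupoid G] {R : Type*} [CommRing R]
    (C E : G → Type*)
    [∀ x, AddCommGroup (C x)] [∀ x, Module R (C x)]
    [∀ x, AddCommGroup (E x)] [∀ x, Module R (E x)]
    (d : ∀ x, C x →ₗ[R] E x)
    (ΔC : ∀ {x y : G}, (x ⟶ y) → (C x →ₗ[R] C y))
    (ΔE : ∀ {x y : G}, (x ⟶ y) → (E x →ₗ[R] E y))
    (Ω : ∀ {x y z : G}, (y ⟶ z) → (x ⟶ y) → (E x →ₗ[R] C z))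
    -- (i) ∂ ∘ Δ^C_g = Δ^E_g ∘ ∂
    (h1 : ∀ {x y : G} (g : x ⟶ y), d y ∘ₗ ΔC g = ΔE g ∘ₗ d x)
    -- (ii) Δ^C_{g₁g₂} − Δ^C_{g₁} ∘ Δ^C_{g₂} = Ω_{g₁,g₂} ∘ ∂
    (h2 : ∀ {x y z : G} (g₁ : y ⟶ z) (g₂ : x ⟶ y),
      ΔC (g₂ ≫ g₁) - ΔC g₁ ∘ₗ ΔC g₂ = Ω g₁ g₂ ∘ₗ d x)
    -- (iii) ∂ ∘ Ω_{g₁,g₂} = Δ^E_{g₁g₂} − Δ^E_{g₁} ∘ Δ^E_{g₂}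
    (h3 : ∀ {x y z : G} (g₁ : y ⟶ z) (g₂ : x ⟶ y),
      d z ∘ₗ Ω g₁ g₂ = ΔE (g₂ ≫ g₁) - ΔE g₁ ∘ₗ ΔE g₂)
    -- (iv) cocycle condition
    (h4 : ∀ {w x y z : G} (g₁ : y ⟶ z) (g₂ : x ⟶ y) (g₃ : w ⟶ x),
      Ω (g₂ ≫ g₁) g₃ - Ω g₁ (g₃ ≫ g₂) = ΔC g₁ ∘ₗ Ω g₂ g₃ - Ω g₁ g₂ ∘ₗ ΔE g₃)
    -- unital:
    (huC : ∀ x : G, ΔC (𝟙 x) = LinearMap.id)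
    (huE : ∀ x : G, ΔE (𝟙 x) = LinearMap.id)
    -- normalized:
    (hn1 : ∀ {x y : G} (g : x ⟶ y), Ω (𝟙 y) g = 0)
    (hn2 : ∀ {x y : G} (g : x ⟶ y), Ω g (𝟙 x) = 0)
    {x y : G} (g : x ⟶ y) (c : C y) (e : E x) :
    -- ι(c,g,e) is composable with (c,g,e) on the left (source of ι = target of (c,g,e))
    -- holds by construction; the product ι(c,g,e)·(c,g,e) equals the unit (0, 𝟙 x, e):
    ((Ω (Groupoid.inv g) g e - ΔC (Groupoid.inv g) c) + ΔC (Groupoid.inv g) c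
        - Ω (Groupoid.inv g) g e = 0 ∧
      g ≫ Groupoid.inv g = 𝟙 x) ∧
    -- (c,g,e) is composable with ι(c,g,e) on the right:
    (e = d x (Ω (Groupoid.inv g) g e - ΔC (Groupoid.inv g) c)
        + ΔE (Groupoid.inv g) (d y c + ΔE g e)) ∧
    -- and the product (c,g,e)·ι(c,g,e) equals the unit (0, 𝟙 y, ∂ c + Δ^E_g e):
    (c + ΔC g (Ω (Groupoid.inv g) g e - ΔC (Groupoid.inv g) c)
        - Ω g (Groupoid.inv g) (d y c + ΔE g e) = 0 ∧
      Groupoid.inv g ≫ g = 𝟙 y) := by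
  have gi := Groupoid.comp_inv g
  have ig := Groupoid.inv_comp g
  refine ⟨⟨by abel, gi⟩, ?_, ?_, ig⟩
  · have hd := LinearMap.congr_fun (h1 (Groupoid.inv g)) c
    have hΩ := LinearMap.congr_fun (h3 (Groupoid.inv g) g) e
    rw [gi, huE] at hΩ
    simp only [LinearMap.comp_apply, LinearMap.sub_apply, LinearMap.id_apply] at hd hΩ
    rw [map_sub, map_add, hd, hΩ]
    abel
  · have hC := LinearMap.congr_fun (h2 g (Groupoid.inv g)) c
    have hΩ := LinearMap.congr_fun (h4 g (Groupoid.inv g) g) e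
    rw [ig, huC] at hC
    rw [ig, gi, hn1, hn2] at hΩ
    simp only [LinearMap.comp_apply, LinearMap.sub_apply, LinearMap.id_apply,
      LinearMap.zero_apply, sub_zero] at hC hΩ
    rw [map_sub, map_add, ← hC, ← sub_eq_zero.mp hΩ.symm]
    abel
end

section
/- Variation of the propagator with respect to a parameter (Duhamel formula): let V be a real Banach space, let A : ℝ × ℝ → L(V,V) be continuous with a jointly continuous partial derivative ∂_sA in the second variable, and let P be an s-differentiable propagator for A. Then for every s, ∂_sP(1,0;s) = ∫₀¹ P(1,t;s) ∘ (∂_sA)(t,s) ∘ P(t,0;s) dt. -/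
open MeasureTheory Set in
/-- Differentiation under the integral sign over a compact interval, for an integrand whose
parameter derivative is jointly continuous. -/
theorem hasDerivAt_intervalIntegral_of_continuous_deriv
    {E : Type*} [NormedAddCommGroup E] [NormedSpace ℝ E] {F F' : ℝ → ℝ → E} {a b : ℝ}
    (hF : Continuous fun p : ℝ × ℝ => F p.1 p.2) (hF' : Continuous fun p : ℝ × ℝ => F' p.1 p.2)
    (hderiv : ∀ x t, HasDerivAt (fun y => F y t) (F' x t) x) (x : ℝ) :
    HasDerivAt (fun y => ∫ t in a..b, F y t) (∫ t in a..b, F' x t) x := by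
  have hFx (y : ℝ) : Continuous (F y) := hF.comp (Continuous.prodMk_right y)
  have hFx' (y : ℝ) : Continuous (F' y) := hF'.comp (Continuous.prodMk_right y)
  obtain ⟨C, hC⟩ := ((isCompact_Icc (a := x - 1) (b := x + 1)).prod
    (isCompact_uIcc (a := a) (b := b))).exists_bound_of_continuousOn hF'.continuousOn
  refine (intervalIntegral.hasDerivAt_integral_of_dominated_loc_of_deriv_le (F := F) (F' := F')
    (bound := fun _ => C) (Icc_mem_nhds (by linarith : x - 1 < x) (by linarith : x < x + 1))
    (.of_forall fun y => (hFx y).aestronglyMeasurable) ((hFx x).intervalIntegrable a b)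
    (hFx' x).aestronglyMeasurable (.of_forall fun t ht y hy => ?_)
    intervalIntegrable_const (.of_forall fun t _ y _ => hderiv y t)).2
  exact hC (y, t) ⟨hy, uIoc_subset_uIcc ht⟩

/-- A function of two variables is jointly continuous if it is continuous in the first variable for
one value of the second and has a jointly continuous derivative in the second. -/
theorem continuous_of_continuous_of_hasDerivAt
    {X E : Type*} [TopologicalSpace X] [NormedAddCommGroup E] [NormedSpace ℝ E] [CompleteSpace E]
    {f f' : X → ℝ → E} {s₀ : ℝ} (hf : Continuous fun x => f x s₀)
    (hf' : Continuous fun p : X × ℝ => f' p.1 p.2)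
    (hderiv : ∀ x s, HasDerivAt (f x) (f' x s) s) :
    Continuous fun p : X × ℝ => f p.1 p.2 := by
  have key : (fun p : X × ℝ => f p.1 p.2) =
      fun p => f p.1 s₀ + ∫ u in s₀..p.2, f' p.1 u := by
    funext p
    rw [intervalIntegral.integral_eq_sub_of_hasDerivAt (fun u _ => hderiv p.1 u)
      ((hf'.comp (Continuous.prodMk_right p.1)).intervalIntegrable _ _)]
    abel
  rw [key]
  exact (hf.comp continuous_fst).add
    (intervalIntegral.continuous_parametric_primitive_of_continuous (f := f') hf')

/-- The backward evolution equation: if `U t' t` is the propagator of `U′ = A ∘ U`, then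
`t ↦ U t' t` has derivative `-U t' t ∘ A t`. -/
theorem hasDerivAt_propagator_initial_time
    {V : Type*} [NormedAddCommGroup V] [NormedSpace ℝ V] [CompleteSpace V]
    {A : ℝ → V →L[ℝ] V} {U : ℝ → ℝ → V →L[ℝ] V}
    (hid : ∀ t, U t t = ContinuousLinearMap.id ℝ V)
    (hcomp : ∀ t'' t' t, (U t'' t').comp (U t' t) = U t'' t)
    (hderiv : ∀ t' t, HasDerivAt (fun u => U u t) ((A t').comp (U t' t)) t') (t' t : ℝ) :
    HasDerivAt (fun u => U t' u) (-(U t' t).comp (A t)) t := by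
  let unit (u : ℝ) : (V →L[ℝ] V)ˣ :=
    ⟨U u t', U t' u, (hcomp _ _ _).trans (hid _), (hcomp _ _ _).trans (hid _)⟩
  have hinv : (fun u => U t' u) = Ring.inverse ∘ fun u => U u t' :=
    funext fun u => (Ring.inverse_unit (unit u)).symm
  rw [hinv]
  refine (HasFDerivAt.comp_hasDerivAt t (hasFDerivAt_ringInverse (𝕜 := ℝ) (unit t))
    (hderiv t t')).congr_deriv ?_
  change -((U t' t).comp ((A t).comp (U t t'))).comp (U t' t) = _
  rw [ContinuousLinearMap.comp_assoc, ContinuousLinearMap.comp_assoc, hcomp, hid,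
    ContinuousLinearMap.comp_id]

/-- Two propagators differ by the integral of the difference of their generators. -/
theorem propagator_sub_propagator_eq_integral
    {V : Type*} [NormedAddCommGroup V] [NormedSpace ℝ V] [CompleteSpace V]
    {A B : ℝ → V →L[ℝ] V} (hA : Continuous A) (hB : Continuous B) {U W : ℝ → ℝ → V →L[ℝ] V}
    (hUid : ∀ t, U t t = ContinuousLinearMap.id ℝ V)
    (hUcomp : ∀ t'' t' t, (U t'' t').comp (U t' t) = U t'' t)
    (hU : ∀ t' t, HasDerivAt (fun u => U u t) ((A t').comp (U t' t)) t')
    (hWid : ∀ t, W t t = ContinuousLinearMap.id ℝ V)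
    (hW : ∀ t' t, HasDerivAt (fun u => W u t) ((B t').comp (W t' t)) t') (a b : ℝ) :
    W b a - U b a = ∫ t in a..b, (U b t).comp ((B t - A t).comp (W t a)) := by
  have hUback := hasDerivAt_propagator_initial_time hUid hUcomp hU b
  have hUcont : Continuous fun t => U b t :=
    continuous_iff_continuousAt.2 fun t => (hUback t).continuousAt
  have hWcont : Continuous fun t => W t a :=
    continuous_iff_continuousAt.2 fun t => (hW t a).continuousAt
  rw [intervalIntegral.integral_eq_sub_of_hasDerivAt (f := fun t => (U b t).comp (W t a)),
    hUid, hWid, ContinuousLinearMap.id_comp, ContinuousLinearMap.comp_id]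
  · intro t _
    refine ((hUback t).clm_comp (hW t a)).congr_deriv ?_
    ext v
    simp
    abel
  · exact (hUcont.clm_comp ((hB.sub hA).clm_comp hWcont)).intervalIntegrable a b


/-- Variation of the propagator with respect to a parameter (Duhamel
formula).  If `P(t',t;s)` is the propagator of the non-autonomous linear ODE
`U′ = A(·,s) ∘ U`, differentiable in `s` with jointly continuous `s`-derivative `Ps`,
and `A` has a jointly continuous partial derivative `As` in the second variable, then
`∂ₛP(1,0;s) = ∫₀¹ P(1,t;s) ∘ (∂ₛA)(t,s) ∘ P(t,0;s) dt`. -/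
theorem propagator_parameter_derivative
    {V : Type*} [NormedAddCommGroup V] [NormedSpace ℝ V] [CompleteSpace V]
    (A : ℝ → ℝ → V →L[ℝ] V)
    (hA : Continuous fun p : ℝ × ℝ => A p.1 p.2)
    (As : ℝ → ℝ → V →L[ℝ] V)
    (hAs : ∀ t s, HasDerivAt (fun u => A t u) (As t s) s)
    (hAscont : Continuous fun p : ℝ × ℝ => As p.1 p.2)
    (P : ℝ → ℝ → ℝ → V →L[ℝ] V)
    (hPid : ∀ t s, P t t s = ContinuousLinearMap.id ℝ V)
    (hPcomp : ∀ t'' t' t s, (P t'' t' s).comp (P t' t s) = P t'' t s)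
    (hPderiv : ∀ t' t s, HasDerivAt (fun u => P u t s) ((A t' s).comp (P t' t s)) t')
    (Ps : ℝ → ℝ → ℝ → V →L[ℝ] V)
    (hPs : ∀ t' t s, HasDerivAt (fun u => P t' t u) (Ps t' t s) s)
    (hPscont : Continuous fun p : ℝ × ℝ × ℝ => Ps p.1 p.2.1 p.2.2) :
    ∀ s, Ps 1 0 s = ∫ t in (0:ℝ)..1, (P 1 t s).comp ((As t s).comp (P t 0 s)) := by
  intro s
  have hAt (u : ℝ) : Continuous fun t => A t u := hA.comp (Continuous.prodMk_left u)
  have hP₁ : Continuous fun t => P 1 t s := continuous_iff_continuousAt.2 fun t =>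
    (hasDerivAt_propagator_initial_time (A := fun t => A t s) (U := fun t' t => P t' t s)
      (fun t => hPid t s) (fun t'' t' t => hPcomp t'' t' t s) (fun t' t => hPderiv t' t s)
      1 t).continuousAt
  have hPs₀ : Continuous fun p : ℝ × ℝ => Ps p.1 0 p.2 :=
    hPscont.comp (continuous_fst.prodMk (continuous_const.prodMk continuous_snd))
  have hP₀ : Continuous fun p : ℝ × ℝ => P p.1 0 p.2 :=
    continuous_of_continuous_of_hasDerivAt (f := fun t u => P t 0 u) (s₀ := s)
      (continuous_iff_continuousAt.2 fun t => (hPderiv t 0 s).continuousAt) hPs₀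
      (fun t u => hPs t 0 u)
  have hdiff (u : ℝ) : P 1 0 u - P 1 0 s =
      ∫ t in (0:ℝ)..1, (P 1 t s).comp ((A t u - A t s).comp (P t 0 u)) :=
    propagator_sub_propagator_eq_integral (U := fun t' t => P t' t s)
      (W := fun t' t => P t' t u) (hAt s) (hAt u)
      (fun t => hPid t s) (fun t'' t' t => hPcomp t'' t' t s) (fun t' t => hPderiv t' t s)
      (fun t => hPid t u) (fun t' t => hPderiv t' t u) 0 1
  have hP₁' : Continuous fun p : ℝ × ℝ => P 1 p.2 s := hP₁.comp continuous_snd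
  have hsub : Continuous fun p : ℝ × ℝ => A p.2 p.1 - A p.2 s :=
    (hA.comp continuous_swap).sub ((hAt s).comp continuous_snd)
  have hP₀' : Continuous fun p : ℝ × ℝ => P p.2 0 p.1 := hP₀.comp continuous_swap
  have hPs₀' : Continuous fun p : ℝ × ℝ => Ps p.2 0 p.1 := hPs₀.comp continuous_swap
  have hAs' : Continuous fun p : ℝ × ℝ => As p.2 p.1 := hAscont.comp continuous_swap
  have hint := hasDerivAt_intervalIntegral_of_continuous_deriv (a := 0) (b := 1)
    (F := fun u t => (P 1 t s).comp ((A t u - A t s).comp (P t 0 u)))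
    (F' := fun u t => (P 1 t s).comp
      ((As t u).comp (P t 0 u) + (A t u - A t s).comp (Ps t 0 u)))
    (hP₁'.clm_comp (hsub.clm_comp hP₀'))
    (hP₁'.clm_comp ((hAs'.clm_comp hP₀').add (hsub.clm_comp hPs₀')))
    (fun u t => by
      simpa using (hasDerivAt_const u (P 1 t s)).clm_comp
        (((hAs t u).sub_const (A t s)).clm_comp (hPs t 0 u))) s
  simp only [← hdiff, sub_self, ContinuousLinearMap.zero_comp, add_zero] at hint
  exact ((hPs 1 0 s).sub_const _).unique hint
end

section
/- Nijenhuis formula relating parallel transport and curvature: let V be a real Banach space, let A : ℝ × ℝ → L(V,V) be continuous with a jointly continuous partial derivative ∂_sA in the second variable, let P be an s-differentiable propagator for A, and let B : ℝ × ℝ → L(V,V) be continuous with a jointly continuous partial derivative ∂_tB in the first variable. Define the curvature F(t,s) := (∂_sA)(t,s) − (∂_tB)(t,s) + A(t,s) ∘ B(t,s) − B(t,s) ∘ A(t,s). Then for every s, ∂_sP(1,0;s) = B(1,s) ∘ P(1,0;s) − P(1,0;s) ∘ B(0,s) + ∫₀¹ P(1,t;s) ∘ F(t,s) ∘ P(t,0;s)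 dt. -/
/-- Differentiation under an interval integral with jointly continuous derivative. -/
theorem hasDerivAt_intervalIntegral_of_continuous {E : Type*} [NormedAddCommGroup E]
    [NormedSpace ℝ E] [CompleteSpace E] {F F' : ℝ → ℝ → E} (a b x₀ : ℝ)
    (hF : ∀ x, Continuous (F x)) (hF' : Continuous fun p : ℝ × ℝ => F' p.1 p.2)
    (hderiv : ∀ x t, HasDerivAt (fun y => F y t) (F' x t) x) :
    HasDerivAt (fun x => ∫ t in a..b, F x t) (∫ t in a..b, F' x₀ t) x₀ := by
  obtain ⟨C, hC⟩ := ((isCompact_closedBall x₀ 1).prod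
    (isCompact_uIcc (a := a) (b := b))).exists_bound_of_continuousOn hF'.continuousOn
  refine (intervalIntegral.hasDerivAt_integral_of_dominated_loc_of_deriv_le (bound := fun _ => C)
    (Metric.closedBall_mem_nhds x₀ one_pos) (.of_forall fun x => (hF x).aestronglyMeasurable)
    ((hF x₀).intervalIntegrable a b) ?_ (.of_forall fun t ht x hx => ?_)
    intervalIntegrable_const (.of_forall fun t _ x _ => hderiv x t)).2
  · exact (hF'.comp (Continuous.prodMk_right x₀)).aestronglyMeasurable
  · exact hC (x, t) ⟨hx, Set.uIoc_subset_uIcc ht⟩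

/-- A function that is continuous in the first variable and has a jointly continuous partial
derivative in the second one is jointly continuous. -/
theorem continuous_uncurry_of_continuous_partialDeriv {E : Type*} [NormedAddCommGroup E]
    [NormedSpace ℝ E] [CompleteSpace E] {U U' : ℝ → ℝ → E}
    (hU : ∀ s, Continuous fun t => U t s) (hderiv : ∀ t s, HasDerivAt (U t) (U' t s) s)
    (hU' : Continuous fun p : ℝ × ℝ => U' p.1 p.2) :
    Continuous fun p : ℝ × ℝ => U p.1 p.2 := by
  have hint : (fun p : ℝ × ℝ => U p.1 p.2) =
      fun p => U p.1 0 + ∫ u in (0 : ℝ)..p.2, U' p.1 u := by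
    ext p
    rw [intervalIntegral.integral_eq_sub_of_hasDerivAt (fun u _ => hderiv p.1 u)
      ((hU'.comp (Continuous.prodMk_right p.1)).intervalIntegrable _ _)]
    abel
  rw [hint]
  refine ((hU 0).comp continuous_fst).add ?_
  refine intervalIntegral.continuous_parametric_intervalIntegral_of_continuous
    (f := fun (p : ℝ × ℝ) u => U' p.1 u) ?_ continuous_snd
  exact hU'.comp (by fun_prop : Continuous fun q : (ℝ × ℝ) × ℝ => (q.1.1, q.2))

section Propagator

variable {R : Type*} [NormedRing R] [NormedAlgebra ℝ R] [CompleteSpace R]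

/-- The derivative of a propagator in its initial time. -/
theorem hasDerivAt_propagator_initial {a : ℝ → R} {P : ℝ → ℝ → R} (hPid : ∀ t, P t t = 1)
    (hPcomp : ∀ t'' t' t, P t'' t' * P t' t = P t'' t)
    (hPderiv : ∀ t' t, HasDerivAt (fun u => P u t) (a t' * P t' t) t') (r t : ℝ) :
    HasDerivAt (fun u => P r u) (-(P r t * a t)) t := by
  let unit (u : ℝ) : Rˣ := ⟨P u r, P r u, by rw [hPcomp, hPid], by rw [hPcomp, hPid]⟩
  have hinv : (fun u => P r u) = fun u => Ring.inverse (P u r) := by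
    ext u
    exact (Ring.inverse_unit (unit u)).symm
  rw [hinv]
  have h := (hasFDerivAt_ringInverse (𝕜 := ℝ) (unit t)).comp_hasDerivAt t (hPderiv t r)
  convert! h using 1
  change -(P r t * a t) = -(P r t * (a t * P t r) * P r t)
  rw [mul_assoc, mul_assoc, hPcomp, hPid, mul_one]

variable {A As : ℝ → ℝ → R} {P Ps : ℝ → ℝ → ℝ → R}

/-- The derivative of a propagator with respect to a parameter of the generator. -/
theorem propagator_paramDeriv_eq_integral (hA : Continuous fun p : ℝ × ℝ => A p.1 p.2)
    (hAs : ∀ t s, HasDerivAt (A t) (As t s) s)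
    (hAscont : Continuous fun p : ℝ × ℝ => As p.1 p.2)
    (hPid : ∀ t s, P t t s = 1)
    (hPcomp : ∀ t'' t' t s, P t'' t' s * P t' t s = P t'' t s)
    (hPderiv : ∀ t' t s, HasDerivAt (fun u => P u t s) (A t' s * P t' t s) t')
    (hPs : ∀ t' t s, HasDerivAt (P t' t) (Ps t' t s) s)
    (hPscont : Continuous fun p : ℝ × ℝ × ℝ => Ps p.1 p.2.1 p.2.2) (a b s : ℝ) :
    Ps b a s = ∫ t in a..b, P b t s * As t s * P t a s := by
  have hinit (t x : ℝ) : HasDerivAt (fun u => P b u x) (-(P b t x * A t x)) t :=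
    hasDerivAt_propagator_initial (a := fun t => A t x) (P := fun t' t => P t' t x)
      (fun t => hPid t x) (fun t'' t' t => hPcomp t'' t' t x)
      (fun t' t => hPderiv t' t x) b t
  have hPb : Continuous fun t => P b t s :=
    continuous_iff_continuousAt.2 fun t => (hinit t s).continuousAt
  have hPs' : Continuous fun p : ℝ × ℝ => Ps p.1 a p.2 :=
    hPscont.comp (by fun_prop : Continuous fun p : ℝ × ℝ => (p.1, a, p.2))
  have hPa : Continuous fun p : ℝ × ℝ => P p.1 a p.2 :=
    continuous_uncurry_of_continuous_partialDeriv (U := fun t x => P t a x)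
      (fun x => continuous_iff_continuousAt.2 fun t => (hPderiv t a x).continuousAt)
      (fun t x => hPs t a x) hPs'
  let F (x t : ℝ) : R := P b t s * (A t x - A t s) * P t a x
  let F' (x t : ℝ) : R := P b t s * (As t x * P t a x + (A t x - A t s) * Ps t a x)
  have hF (x : ℝ) : Continuous (F x) := by
    have h1 (y : ℝ) : Continuous fun t => A t y := hA.comp (Continuous.prodMk_left y)
    have h2 : Continuous fun t => P t a x := hPa.comp (Continuous.prodMk_left x)
    exact (hPb.mul ((h1 x).sub (h1 s))).mul h2
  have hF' : Continuous fun p : ℝ × ℝ => F' p.1 p.2 := by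
    have h1 : Continuous fun p : ℝ × ℝ => A p.2 s :=
      hA.comp (by fun_prop : Continuous fun p : ℝ × ℝ => (p.2, s))
    exact (hPb.comp continuous_snd).mul (((hAscont.comp continuous_swap).mul
      (hPa.comp continuous_swap)).add (((hA.comp continuous_swap).sub h1).mul
        (hPs'.comp continuous_swap)))
  have hFderiv (x t : ℝ) : HasDerivAt (fun y => F y t) (F' x t) x := by
    have h := (((hAs t x).sub_const (A t s)).mul (hPs t a x)).const_mul (P b t s)
    simpa only [F, F', mul_assoc] using! h
  have hduhamel (x : ℝ) : P b a x - P b a s = ∫ t in a..b, F x t := by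
    have h (t : ℝ) : HasDerivAt (fun u => P b u s * P u a x) (F x t) t := by
      convert! (hinit t s).mul (hPderiv t a x) using 1
      simp only [F]
      noncomm_ring
    rw [intervalIntegral.integral_eq_sub_of_hasDerivAt (fun t _ => h t)
      ((hF x).intervalIntegrable _ _), hPid, hPid, one_mul, mul_one]
  have hleft : HasDerivAt (fun x => ∫ t in a..b, F x t) (Ps b a s) s := by
    simp only [← hduhamel]
    exact (hPs b a s).sub_const _
  rw [hleft.unique (hasDerivAt_intervalIntegral_of_continuous a b s hF hF' hFderiv)]
  simp only [F', sub_self, zero_mul, add_zero, mul_assoc]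

/-- The fundamental theorem of calculus for a function conjugated by a propagator. -/
theorem integral_propagator_conj {a c c' : ℝ → R} {P : ℝ → ℝ → R} (hPid : ∀ t, P t t = 1)
    (hPcomp : ∀ t'' t' t, P t'' t' * P t' t = P t'' t)
    (hPderiv : ∀ t' t, HasDerivAt (fun u => P u t) (a t' * P t' t) t')
    (ha : Continuous a) (hc : ∀ t, HasDerivAt c (c' t) t) (hc' : Continuous c') (r q : ℝ) :
    ∫ t in r..q, P q t * (c' t - a t * c t + c t * a t) * P t r = c q * P q r - P q r * c r := by
  have hinit := hasDerivAt_propagator_initial hPid hPcomp hPderiv q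
  have hcc : Continuous c := continuous_iff_continuousAt.2 fun t => (hc t).continuousAt
  have hPq : Continuous (P q) := continuous_iff_continuousAt.2 fun t => (hinit t).continuousAt
  have hPr : Continuous fun t => P t r :=
    continuous_iff_continuousAt.2 fun t => (hPderiv t r).continuousAt
  have h (t : ℝ) : HasDerivAt (fun u => P q u * c u * P u r)
      (P q t * (c' t - a t * c t + c t * a t) * P t r) t := by
    convert! ((hinit t).mul (hc t)).mul (hPderiv t r) using 1
    simp only [Pi.mul_apply]
    noncomm_ring
  rw [intervalIntegral.integral_eq_sub_of_hasDerivAt (fun t _ => h t)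
    (Continuous.intervalIntegrable (by fun_prop) _ _), hPid, hPid, one_mul, mul_one]

end Propagator


/-- Nijenhuis formula relating parallel transport and curvature.
With `P` the `s`-differentiable propagator of `U′ = A(·,s) ∘ U`, `B` continuous with
jointly continuous `∂ₜB`, and curvature
`F(t,s) = (∂ₛA)(t,s) − (∂ₜB)(t,s) + A(t,s)∘B(t,s) − B(t,s)∘A(t,s)`, one has
`∂ₛP(1,0;s) = B(1,s)∘P(1,0;s) − P(1,0;s)∘B(0,s) + ∫₀¹ P(1,t;s)∘F(t,s)∘P(t,0;s) dt`. -/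
theorem nijenhuis_curvature_formula
    {V : Type*} [NormedAddCommGroup V] [NormedSpace ℝ V] [CompleteSpace V]
    (A : ℝ → ℝ → V →L[ℝ] V)
    (hA : Continuous fun p : ℝ × ℝ => A p.1 p.2)
    (As : ℝ → ℝ → V →L[ℝ] V)
    (hAs : ∀ t s, HasDerivAt (fun u => A t u) (As t s) s)
    (hAscont : Continuous fun p : ℝ × ℝ => As p.1 p.2)
    (P : ℝ → ℝ → ℝ → V →L[ℝ] V)
    (hPid : ∀ t s, P t t s = ContinuousLinearMap.id ℝ V)
    (hPcomp : ∀ t'' t' t s, (P t'' t' s).comp (P t' t s) = P t'' t s)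
    (hPderiv : ∀ t' t s, HasDerivAt (fun u => P u t s) ((A t' s).comp (P t' t s)) t')
    (Ps : ℝ → ℝ → ℝ → V →L[ℝ] V)
    (hPs : ∀ t' t s, HasDerivAt (fun u => P t' t u) (Ps t' t s) s)
    (hPscont : Continuous fun p : ℝ × ℝ × ℝ => Ps p.1 p.2.1 p.2.2)
    (B : ℝ → ℝ → V →L[ℝ] V)
    (hB : Continuous fun p : ℝ × ℝ => B p.1 p.2)
    (Bt : ℝ → ℝ → V →L[ℝ] V)
    (hBt : ∀ t s, HasDerivAt (fun u => B u s) (Bt t s) t)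
    (hBtcont : Continuous fun p : ℝ × ℝ => Bt p.1 p.2) :
    ∀ s, Ps 1 0 s =
      (B 1 s).comp (P 1 0 s) - (P 1 0 s).comp (B 0 s) +
        ∫ t in (0:ℝ)..1,
          (P 1 t s).comp
            ((As t s - Bt t s + (A t s).comp (B t s) - (B t s).comp (A t s)).comp
              (P t 0 s)) := by
  intro s
  have hslice {f : ℝ → ℝ → V →L[ℝ] V} (hf : Continuous fun p : ℝ × ℝ => f p.1 p.2) :
      Continuous fun t => f t s := hf.comp (Continuous.prodMk_left s)
  have hPb := hasDerivAt_propagator_initial (a := fun t => A t s) (P := fun t' t => P t' t s)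
    (fun t => hPid t s) (fun t'' t' t => hPcomp t'' t' t s) (fun t' t => hPderiv t' t s) 1
  have hP1 : Continuous fun t => P 1 t s :=
    continuous_iff_continuousAt.2 fun t => (hPb t).continuousAt
  have hP0 : Continuous fun t => P t 0 s :=
    continuous_iff_continuousAt.2 fun t => (hPderiv t 0 s).continuousAt
  have hparam := propagator_paramDeriv_eq_integral hA hAs hAscont hPid hPcomp hPderiv hPs
    hPscont 0 1 s
  have hconj := integral_propagator_conj (a := fun t => A t s) (P := fun t' t => P t' t s)
    (fun t => hPid t s) (fun t'' t' t => hPcomp t'' t' t s) (fun t' t => hPderiv t' t s)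
    (hslice hA) (fun t => hBt t s) (hslice hBtcont) 0 1
  have hAc := hslice hA
  have hAsc := hslice hAscont
  have hBc := hslice hB
  have hBtc := hslice hBtcont
  simp only [← ContinuousLinearMap.mul_def]
  rw [hparam, ← hconj, ← intervalIntegral.integral_add
    (Continuous.intervalIntegrable (by fun_prop) _ _)
    (Continuous.intervalIntegrable (by fun_prop) _ _)]
  refine intervalIntegral.integral_congr fun t _ => ?_
  noncomm_ring
end

section
/- Type-1 holonomy formula (trivialized form): let V be a real Banach space, let A : ℝ × ℝ → L(V,V) be continuous with a jointly continuous partial derivative ∂_sA in the second variable, let P be an s-differentiable propagator for A, and let B : ℝ × ℝ → L(V,V) be continuous with a jointly continuous partial derivative ∂_tB in the first variable, satisfying B(0,s) = 0 and B(1,s) = 0 for all s ∈ [0,1]. Define F(t,s) := (∂_sA)(t,s) − (∂_tB)(t,s) + A(t,s) ∘ B(t,s) − B(t,s) ∘ A(t,s). Then ∫₀¹ ∫₀¹ P(1,t;s) ∘ F(t,s) ∘ P(t,0;s) dt ds = P(1,0;1) − P(1,0;0). In particular, when the square represents a sphere (both boundary paths trivial, so P(1,0;0) = P(1,0;1)),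 the double integral of the conjugated curvature vanishes. -/
open Set Topology MeasureTheory in
/-- Differentiation under the integral sign for a jointly continuous derivative. -/
theorem hasDerivAt_intervalIntegral_of_continuous_s12 {E : Type*} [NormedAddCommGroup E]
    [NormedSpace ℝ E] {f f' : ℝ → ℝ → E}
    (hf : ∀ s, Continuous fun t => f t s)
    (hf' : Continuous fun p : ℝ × ℝ => f' p.1 p.2)
    (hd : ∀ t s, HasDerivAt (fun u => f t u) (f' t s) s) (a b s : ℝ) :
    HasDerivAt (fun u => ∫ t in a..b, f t u) (∫ t in a..b, f' t s) s := by
  obtain ⟨C, hC⟩ :=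
    ((isCompact_uIcc (a := a) (b := b)).prod
      (isCompact_Icc (a := s - 1) (b := s + 1))).exists_bound_of_continuousOn hf'.continuousOn
  have hs : Icc (s - 1) (s + 1) ∈ 𝓝 s := Icc_mem_nhds (by linarith) (by linarith)
  refine (intervalIntegral.hasDerivAt_integral_of_dominated_loc_of_deriv_le
    (F := fun u t => f t u) (F' := fun u t => f' t u) (bound := fun _ => C) hs
    (.of_forall fun u => (hf u).aestronglyMeasurable) ((hf s).intervalIntegrable _ _)
    (Continuous.aestronglyMeasurable (by fun_prop)) (.of_forall fun t ht u hu => ?_)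
    intervalIntegrable_const (.of_forall fun t _ u _ => hd t u)).2
  exact hC (t, u) ⟨uIoc_subset_uIcc ht, hu⟩

/-- A function of two real variables that is continuous in the first one and has a jointly
continuous derivative in the second one is jointly continuous. -/
theorem continuous_of_continuous_left_of_hasDerivAt_right {E : Type*} [NormedAddCommGroup E]
    [NormedSpace ℝ E] [CompleteSpace E] {f f' : ℝ → ℝ → E}
    (hf : ∀ s, Continuous fun t => f t s)
    (hf' : Continuous fun p : ℝ × ℝ => f' p.1 p.2)
    (hd : ∀ t s, HasDerivAt (fun u => f t u) (f' t s) s) :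
    Continuous fun p : ℝ × ℝ => f p.1 p.2 := by
  have h : (fun p : ℝ × ℝ => f p.1 p.2) =
      fun p => f p.1 0 + ∫ u in (0 : ℝ)..p.2, f' p.1 u := by
    funext p
    rw [intervalIntegral.integral_eq_sub_of_hasDerivAt (fun u _ => hd p.1 u)
      (Continuous.intervalIntegrable (by fun_prop) _ _)]
    abel
  rw [h]
  refine ((hf 0).comp continuous_fst).add ?_
  exact intervalIntegral.continuous_parametric_intervalIntegral_of_continuous
    (f := fun p : ℝ × ℝ => f' p.1) (by fun_prop) continuous_snd

/-- Symmetry of mixed partial derivatives: `∂ₜ∂ₛf` exists and equals `∂ₛ∂ₜf`. -/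
theorem hasDerivAt_mixed_partial {E : Type*} [NormedAddCommGroup E]
    [NormedSpace ℝ E] [CompleteSpace E] {f ft fs fts : ℝ → ℝ → E}
    (hft : ∀ t s, HasDerivAt (fun u => f u s) (ft t s) t)
    (hfs : ∀ t s, HasDerivAt (fun u => f t u) (fs t s) s)
    (hfts : ∀ t s, HasDerivAt (fun u => ft t u) (fts t s) s)
    (hft_cont : ∀ s, Continuous fun t => ft t s)
    (hfts_cont : Continuous fun p : ℝ × ℝ => fts p.1 p.2) (t s : ℝ) :
    HasDerivAt (fun u => fs u s) (fts t s) t := by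
  have key : (fun r => fs r s) = fun r => fs 0 s + ∫ u in (0 : ℝ)..r, fts u s := by
    funext r
    have h := (hfs 0 s).add
      (hasDerivAt_intervalIntegral_of_continuous_s12 hft_cont hfts_cont hfts 0 r s)
    refine (hfs r s).unique (h.congr_of_eventuallyEq (.of_forall fun u => ?_))
    simp only [Pi.add_apply]
    rw [intervalIntegral.integral_eq_sub_of_hasDerivAt (fun v _ => hft v u)
      ((hft_cont u).intervalIntegrable _ _)]
    abel
  rw [key]
  have hc : Continuous fun u => fts u s := by fun_prop
  exact (hc.integral_hasStrictDerivAt 0 t).hasDerivAt.const_add _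

/-- If `c` has derivative `c'` and left and right inverse `d`, then `d` has derivative `-d c' d`. -/
theorem HasDerivAt.of_inverse {R : Type*} [NormedRing R] [NormedAlgebra ℝ R] [CompleteSpace R]
    {c d : ℝ → R} {c' : R} {t : ℝ} (hcd : ∀ u, c u * d u = 1) (hdc : ∀ u, d u * c u = 1)
    (hc : HasDerivAt c c' t) : HasDerivAt d (-(d t * c' * d t)) t := by
  let x : ℝ → Rˣ := fun u => ⟨c u, d u, hcd u, hdc u⟩
  have h := HasFDerivAt.comp_hasDerivAt t (hasFDerivAt_ringInverse (𝕜 := ℝ) (x t)) hc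
  have hd : Ring.inverse ∘ c = d := funext fun u => Ring.inverse_unit (x u)
  rw [hd] at h
  exact h

/-- Type-1 holonomy formula (trivialized form).  With `P` the
`s`-differentiable propagator of `U′ = A(·,s) ∘ U`, `B` continuous with jointly
continuous `∂ₜB` vanishing on the boundary `t = 0, 1`, and curvature
`F = ∂ₛA − ∂ₜB + A∘B − B∘A`, one has
`∫₀¹∫₀¹ P(1,t;s) ∘ F(t,s) ∘ P(t,0;s) dt ds = P(1,0;1) − P(1,0;0)`. -/
theorem type_one_holonomy_formula
    {V : Type*} [NormedAddCommGroup V] [NormedSpace ℝ V] [CompleteSpace V]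
    (A : ℝ → ℝ → V →L[ℝ] V)
    (hA : Continuous fun p : ℝ × ℝ => A p.1 p.2)
    (As : ℝ → ℝ → V →L[ℝ] V)
    (hAs : ∀ t s, HasDerivAt (fun u => A t u) (As t s) s)
    (hAscont : Continuous fun p : ℝ × ℝ => As p.1 p.2)
    (P : ℝ → ℝ → ℝ → V →L[ℝ] V)
    (hPid : ∀ t s, P t t s = ContinuousLinearMap.id ℝ V)
    (hPcomp : ∀ t'' t' t s, (P t'' t' s).comp (P t' t s) = P t'' t s)
    (hPderiv : ∀ t' t s, HasDerivAt (fun u => P u t s) ((A t' s).comp (P t' t s)) t')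
    (Ps : ℝ → ℝ → ℝ → V →L[ℝ] V)
    (hPs : ∀ t' t s, HasDerivAt (fun u => P t' t u) (Ps t' t s) s)
    (hPscont : Continuous fun p : ℝ × ℝ × ℝ => Ps p.1 p.2.1 p.2.2)
    (B : ℝ → ℝ → V →L[ℝ] V)
    (hB : Continuous fun p : ℝ × ℝ => B p.1 p.2)
    (Bt : ℝ → ℝ → V →L[ℝ] V)
    (hBt : ∀ t s, HasDerivAt (fun u => B u s) (Bt t s) t)
    (hBtcont : Continuous fun p : ℝ × ℝ => Bt p.1 p.2)
    (hB0 : ∀ s ∈ Set.Icc (0:ℝ) 1, B 0 s = 0)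
    (hB1 : ∀ s ∈ Set.Icc (0:ℝ) 1, B 1 s = 0) :
    (∫ s in (0:ℝ)..1, ∫ t in (0:ℝ)..1,
        (P 1 t s).comp
          ((As t s - Bt t s + (A t s).comp (B t s) - (B t s).comp (A t s)).comp
            (P t 0 s))) =
      P 1 0 1 - P 1 0 0 := by
  have hPt_cont (r s : ℝ) : Continuous fun t => P t r s :=
    continuous_iff_continuousAt.2 fun t => (hPderiv t r s).continuousAt
  have hPcont : Continuous fun p : ℝ × ℝ => P p.1 0 p.2 :=
    continuous_of_continuous_left_of_hasDerivAt_right (f := fun t s => P t 0 s)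
      (f' := fun t s => Ps t 0 s) (hPt_cont 0) (by fun_prop) fun t s => hPs t 0 s
  have hPinv (t s : ℝ) :
      HasDerivAt (fun u => P 1 u s) (-((P 1 t s).comp (A t s))) t := by
    have h := HasDerivAt.of_inverse (c := fun u => P u 1 s) (d := fun u => P 1 u s)
      (fun u => (hPcomp u 1 u s).trans (hPid u s)) (fun u => (hPcomp 1 u 1 s).trans (hPid 1 s))
      (hPderiv t 1 s)
    refine h.congr_deriv (congrArg Neg.neg ?_)
    change ((P 1 t s).comp ((A t s).comp (P t 1 s))).comp (P 1 t s) = _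
    rw [ContinuousLinearMap.comp_assoc, ContinuousLinearMap.comp_assoc, hPcomp, hPid,
      ContinuousLinearMap.comp_id]
  have hPinv_cont (s : ℝ) : Continuous fun t => P 1 t s :=
    continuous_iff_continuousAt.2 fun t => (hPinv t s).continuousAt
  have hPst (t s : ℝ) : HasDerivAt (fun u => Ps u 0 s)
      ((As t s).comp (P t 0 s) + (A t s).comp (Ps t 0 s)) t := by
    refine hasDerivAt_mixed_partial (f := fun t s => P t 0 s)
      (ft := fun t s => (A t s).comp (P t 0 s)) (fs := fun t s => Ps t 0 s)
      (fts := fun t s => (As t s).comp (P t 0 s) + (A t s).comp (Ps t 0 s))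
      (fun t s => hPderiv t 0 s) (fun t s => hPs t 0 s)
      (fun t s => (hAs t s).clm_comp (hPs t 0 s)) (fun s => ?_) ?_ t s
    · have := hPt_cont 0 s
      fun_prop
    · fun_prop
  have hPs0 (s : ℝ) : Ps 0 0 s = 0 := by
    refine (hPs 0 0 s).unique ?_
    simp only [hPid]
    exact hasDerivAt_const _ _
  have inner (s : ℝ) (hs : s ∈ Set.Icc (0 : ℝ) 1) :
      (∫ t in (0:ℝ)..1,
        (P 1 t s).comp
          ((As t s - Bt t s + (A t s).comp (B t s) - (B t s).comp (A t s)).comp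
            (P t 0 s))) = Ps 1 0 s := by
    have hW (t : ℝ) : HasDerivAt
        (fun u => (P 1 u s).comp (Ps u 0 s - (B u s).comp (P u 0 s)))
        ((P 1 t s).comp
          ((As t s - Bt t s + (A t s).comp (B t s) - (B t s).comp (A t s)).comp
            (P t 0 s))) t := by
      refine ((hPinv t s).clm_comp
        ((hPst t s).sub ((hBt t s).clm_comp (hPderiv t 0 s)))).congr_deriv ?_
      ext v
      simp only [ContinuousLinearMap.comp_apply, add_apply, Pi.sub_apply, sub_apply, neg_apply,
        map_add, map_sub]
      abel
    have h1 := hPt_cont 0 s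
    have h2 := hPinv_cont s
    rw [intervalIntegral.integral_eq_sub_of_hasDerivAt (fun t _ => hW t)
      (Continuous.intervalIntegrable (by fun_prop) _ _)]
    simp [hB0 s hs, hB1 s hs, hPid, hPs0]
  rw [intervalIntegral.integral_congr (g := fun s => Ps 1 0 s) fun s hs =>
    inner s (by rwa [Set.uIcc_of_le zero_le_one] at hs)]
  exact intervalIntegral.integral_eq_sub_of_hasDerivAt (fun s _ => hPs 1 0 s)
    (Continuous.intervalIntegrable (by fun_prop) _ _)
end
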